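/- Let 0<q<1 and a,b ∈ ℝ, and let x ≥ 0. Then \int_0^x e^{-t} R(a,b,q,t)\,dt = 1 + e^{-x}\left( \sum_{n=1}^\infty \left( \prod_{j=0}^{n-1}(a+bq^j) \right) \frac{x^n}{n!} \, M(1, n+1, x) \; - \; R(a,b,q,x) \right), where M(1, n+1, x) = \sum_{k=0}^\infty \frac{n! \, x^k}{(n+k)!} is Kummer's confluent hypergeometric function {}_1F_1(1; n+1; x), and all series converge absolutely. -/

import Mathlib

open Finset

/-- The Ramanujan function `R(a,b,q,x) = 1 + ∑_{n≥1} (xⁿ/n!) ∏_{j=0}^{n-1} (a + b qʲ)`,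
written as a single `tsum` (the `n = 0` term equals `1`). -/
noncomputable def ramanujanR (a b q x : ℝ) : ℝ :=
  ∑' n : ℕ, x ^ n / (Nat.factorial n : ℝ) * ∏ j ∈ Finset.range n, (a + b * q ^ j)

/-- Kummer's confluent hypergeometric function `₁F₁(1; n+1; z) = ∑_{k≥0} n! zᵏ/(n+k)!`. -/
noncomputable def kummerM1 (n : ℕ) (z : ℝ) : ℝ :=
  ∑' k : ℕ, (Nat.factorial n : ℝ) * z ^ k / (Nat.factorial (n + k) : ℝ)

open Nat in
theorem factorial_mul_pow_div_factorial_add_le (n k : ℕ) {x : ℝ} (hx : 0 ≤ x) :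
    (n ! : ℝ) * x ^ k / ((n + k)! : ℝ) ≤ x ^ k / (k ! : ℝ) := by
  have h : (n ! : ℝ) * (k ! : ℝ) ≤ ((n + k)! : ℝ) := by
    exact_mod_cast Nat.le_of_dvd (Nat.factorial_pos _)
      (Nat.factorial_mul_factorial_dvd_factorial_add n k)
  rw [div_le_div_iff₀ (by positivity) (by positivity)]
  nlinarith [mul_le_mul_of_nonneg_left h (pow_nonneg hx k)]

theorem summable_kummerM1 (n : ℕ) {x : ℝ} (hx : 0 ≤ x) :
    Summable fun k : ℕ => (Nat.factorial n : ℝ) * x ^ k / (Nat.factorial (n + k) : ℝ) :=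
  (Real.summable_pow_div_factorial x).of_nonneg_of_le (fun _ => by positivity)
    fun k => factorial_mul_pow_div_factorial_add_le n k hx

theorem Real.tsum_pow_div_factorial (x : ℝ) :
    ∑' k : ℕ, x ^ k / (Nat.factorial k : ℝ) = Real.exp x := by
  rw [Real.exp_eq_exp_ℝ, NormedSpace.exp_eq_tsum_div]

theorem kummerM1_nonneg (n : ℕ) {x : ℝ} (hx : 0 ≤ x) : 0 ≤ kummerM1 n x :=
  tsum_nonneg fun _ => by positivity

theorem kummerM1_le_exp (n : ℕ) {x : ℝ} (hx : 0 ≤ x) : kummerM1 n x ≤ Real.exp x := by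
  rw [← Real.tsum_pow_div_factorial]
  exact (summable_kummerM1 n hx).tsum_le_tsum
    (fun k => factorial_mul_pow_div_factorial_add_le n k hx) (Real.summable_pow_div_factorial x)

theorem pow_div_factorial_mul_kummerM1 (n : ℕ) (x : ℝ) :
    x ^ n / (Nat.factorial n : ℝ) * kummerM1 n x =
      Real.exp x - ∑ k ∈ range n, x ^ k / (Nat.factorial k : ℝ) := by
  rw [eq_sub_iff_add_eq', ← Real.tsum_pow_div_factorial,
    ← (Real.summable_pow_div_factorial x).sum_add_tsum_nat_add n, kummerM1, ← tsum_mul_left]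
  congr 2 with k
  rw [add_comm k n]
  field_simp
  ring

theorem hasDerivAt_sum_pow_div_factorial (n : ℕ) (t : ℝ) :
    HasDerivAt (fun t : ℝ => ∑ k ∈ range (n + 1), t ^ k / (Nat.factorial k : ℝ))
      (∑ k ∈ range n, t ^ k / (Nat.factorial k : ℝ)) t := by
  induction n with
  | zero => simpa using hasDerivAt_const t (1 : ℝ)
  | succ n ih =>
    simp only [sum_range_succ _ (n + 1)]
    rw [sum_range_succ]
    refine ih.add ?_
    refine ((hasDerivAt_pow (n + 1) t).div_const (Nat.factorial (n + 1) : ℝ)).congr_deriv ?_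
    rw [Nat.factorial_succ]
    push_cast
    field_simp

theorem integral_exp_neg_mul_pow_div_factorial (n : ℕ) (x : ℝ) :
    ∫ t in (0 : ℝ)..x, Real.exp (-t) * (t ^ n / (Nat.factorial n : ℝ)) =
      1 - Real.exp (-x) * ∑ k ∈ range (n + 1), x ^ k / (Nat.factorial k : ℝ) := by
  have hderiv (t : ℝ) : HasDerivAt
      (fun t : ℝ => -(Real.exp (-t) * ∑ k ∈ range (n + 1), t ^ k / (Nat.factorial k : ℝ)))
      (Real.exp (-t) * (t ^ n / (Nat.factorial n : ℝ))) t := by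
    refine ((hasDerivAt_neg t).exp.mul (hasDerivAt_sum_pow_div_factorial n t)).neg.congr_deriv ?_
    rw [sum_range_succ]
    ring
  rw [intervalIntegral.integral_eq_sub_of_hasDerivAt (fun t _ => hderiv t)
    (Continuous.intervalIntegrable (by fun_prop) _ _)]
  have : ∑ k ∈ range (n + 1), (0 : ℝ) ^ k / (Nat.factorial k : ℝ) = 1 := by
    simp [sum_range_succ']
  rw [this]
  simp
  ring

theorem abs_prod_add_mul_pow_le {q : ℝ} (hq0 : 0 ≤ q) (hq1 : q ≤ 1) (a b : ℝ) (n : ℕ) :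
    |∏ j ∈ range n, (a + b * q ^ j)| ≤ (|a| + |b|) ^ n := by
  rw [abs_prod]
  refine (prod_le_prod (fun _ _ => abs_nonneg _) fun j _ => ?_).trans_eq
    (by rw [prod_const, card_range])
  refine (abs_add_le _ _).trans (add_le_add_right ?_ _)
  rw [abs_mul, abs_of_nonneg (pow_nonneg hq0 j)]
  exact mul_le_of_le_one_right (abs_nonneg b) (pow_le_one₀ hq0 hq1)

theorem abs_ramanujanR_term_le {q : ℝ} (hq0 : 0 ≤ q) (hq1 : q ≤ 1) (a b : ℝ) (n : ℕ) {t x : ℝ}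
    (ht : |t| ≤ x) :
    |t ^ n / (Nat.factorial n : ℝ) * ∏ j ∈ range n, (a + b * q ^ j)| ≤
      ((|a| + |b|) * x) ^ n / (Nat.factorial n : ℝ) := by
  rw [abs_mul, abs_div, abs_pow, Nat.abs_cast, mul_pow, mul_comm, ← mul_div_assoc]
  gcongr
  exact abs_prod_add_mul_pow_le hq0 hq1 a b n

theorem summable_ramanujanR {q : ℝ} (hq0 : 0 ≤ q) (hq1 : q ≤ 1) (a b x : ℝ) :
    Summable fun n : ℕ => x ^ n / (Nat.factorial n : ℝ) * ∏ j ∈ range n, (a + b * q ^ j) :=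
  .of_norm_bounded (Real.summable_pow_div_factorial ((|a| + |b|) * |x|))
    fun n => abs_ramanujanR_term_le hq0 hq1 a b n le_rfl

theorem summable_prod_mul_kummerM1 {q : ℝ} (hq0 : 0 ≤ q) (hq1 : q ≤ 1) (a b : ℝ) {x : ℝ}
    (hx : 0 ≤ x) :
    Summable fun n : ℕ => (∏ j ∈ range n, (a + b * q ^ j)) *
      (x ^ n / (Nat.factorial n : ℝ)) * kummerM1 n x := by
  refine .of_norm_bounded
    ((Real.summable_pow_div_factorial ((|a| + |b|) * x)).mul_right (Real.exp x)) fun n => ?_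
  rw [Real.norm_eq_abs, abs_mul, abs_of_nonneg (kummerM1_nonneg n hx), mul_comm (∏ j ∈ range n, _)]
  exact mul_le_mul (abs_ramanujanR_term_le hq0 hq1 a b n (abs_of_nonneg hx).le)
    (kummerM1_le_exp n hx) (kummerM1_nonneg n hx) (by positivity)

theorem hasSum_integral_exp_neg_mul_ramanujanR {q : ℝ} (hq0 : 0 ≤ q) (hq1 : q ≤ 1) (a b : ℝ)
    {x : ℝ} (hx : 0 ≤ x) :
    HasSum (fun n : ℕ => (1 - Real.exp (-x) *
        ∑ k ∈ range (n + 1), x ^ k / (Nat.factorial k : ℝ)) * ∏ j ∈ range n, (a + b * q ^ j))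
      (∫ t in (0 : ℝ)..x, Real.exp (-t) * ramanujanR a b q t) := by
  simp only [← integral_exp_neg_mul_pow_div_factorial, ← intervalIntegral.integral_mul_const]
  refine intervalIntegral.hasSum_integral_of_dominated_convergence
    (fun n _ => ((|a| + |b|) * x) ^ n / (Nat.factorial n : ℝ))
    (fun n => Continuous.aestronglyMeasurable (by fun_prop)) (fun n => .of_forall fun t ht => ?_)
    (.of_forall fun _ _ => Real.summable_pow_div_factorial _) intervalIntegrable_const
    (.of_forall fun t _ => ?_)
  · rw [Set.uIoc_of_le hx] at ht
    rw [mul_assoc, Real.norm_eq_abs, abs_mul, Real.abs_exp]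
    refine (mul_le_of_le_one_left (abs_nonneg _) ?_).trans
      (abs_ramanujanR_term_le hq0 hq1 a b n ((abs_of_pos ht.1).trans_le ht.2))
    exact Real.exp_le_one_iff.2 (neg_nonpos.2 ht.1.le)
  · simp only [mul_assoc]
    exact (summable_ramanujanR hq0 hq1 a b t).hasSum.mul_left _

theorem Real.exp_neg_mul_exp_self (x : ℝ) : Real.exp (-x) * Real.exp x = 1 := by
  rw [← Real.exp_add, neg_add_cancel, Real.exp_zero]

/-- For `x ≥ 0`,
`∫_0^x e^{-t} R(a,b,q,t) dt
  = 1 + e^{-x} ( ∑_{n≥1} (∏_{j=0}^{n-1}(a+bqʲ)) (xⁿ/n!) ₁F₁(1; n+1; x) − R(a,b,q,x) )`,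
where all the series converge absolutely (the outer series being indexed below by `n+1`). -/
theorem stmt_10 (q a b : ℝ) (hq0 : 0 < q) (hq1 : q < 1) (x : ℝ) (hx : 0 ≤ x) :
    (∀ n : ℕ, Summable (fun k : ℕ =>
      |(Nat.factorial (n + 1) : ℝ) * x ^ k / (Nat.factorial (n + 1 + k) : ℝ)|)) ∧
    Summable (fun n : ℕ =>
      |(∏ j ∈ Finset.range (n + 1), (a + b * q ^ j)) *
        (x ^ (n + 1) / (Nat.factorial (n + 1) : ℝ)) * kummerM1 (n + 1) x|) ∧
    ∫ t in (0:ℝ)..x, Real.exp (-t) * ramanujanR a b q t =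
      1 + Real.exp (-x) *
        ((∑' n : ℕ,
            (∏ j ∈ Finset.range (n + 1), (a + b * q ^ j)) *
              (x ^ (n + 1) / (Nat.factorial (n + 1) : ℝ)) * kummerM1 (n + 1) x) -
          ramanujanR a b q x) := by
  have hA := summable_prod_mul_kummerM1 hq0.le hq1.le a b hx
  have hR := summable_ramanujanR hq0.le hq1.le a b x
  refine ⟨fun n => (summable_kummerM1 (n + 1) hx).abs, ((summable_nat_add_iff 1).2 hA).abs, ?_⟩
  have hzero : kummerM1 0 x = Real.exp x := by
    simpa using pow_div_factorial_mul_kummerM1 0 x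
  have hterm (n : ℕ) : (1 - Real.exp (-x) * ∑ k ∈ range (n + 1), x ^ k / (Nat.factorial k : ℝ)) *
        ∏ j ∈ range n, (a + b * q ^ j) =
      Real.exp (-x) * ((∏ j ∈ range n, (a + b * q ^ j)) * (x ^ n / (Nat.factorial n : ℝ)) *
        kummerM1 n x - x ^ n / (Nat.factorial n : ℝ) * ∏ j ∈ range n, (a + b * q ^ j)) := by
    rw [mul_assoc (∏ j ∈ range n, _), pow_div_factorial_mul_kummerM1, sum_range_succ]
    linear_combination -(∏ j ∈ range n, (a + b * q ^ j)) * (Real.exp_neg_mul_exp_self x)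
  rw [← (hasSum_integral_exp_neg_mul_ramanujanR hq0.le hq1.le a b hx).tsum_eq]
  simp only [hterm]
  rw [tsum_mul_left, hA.tsum_sub hR, hA.tsum_eq_zero_add, hzero, ramanujanR]
  simp only [range_zero, prod_empty, pow_zero, Nat.factorial_zero, Nat.cast_one, div_one, one_mul]
  linear_combination Real.exp_neg_mul_exp_self x
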